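/- Let L/K be an extension of fields equipped with non-archimedean real-valued absolute values agreeing on K, and assume the residue characteristic is zero (char(tilde K) = 0). Then every torsion element of the module of Kähler differentials Ω_{L°/K°} is annihilated by every element of K°°: if x ∈ Ω_{L°/K°} satisfies a·x = 0 for some nonzero a ∈ L°, then c·x = 0 for all c ∈ K°°. -/

import Mathlib

set_option linter.unusedSectionVars false
set_option synthInstance.maxHeartbeats 1000000

variable {L : Type*} [NormedField L] [IsUltrametricDist L]

/-- The ring of integers `L° = {x : ‖x‖ ≤ 1}` of a non-archimedean real-valued field. -/
def unitBallSubring (L : Type*) [NormedField L] [IsUltrametricDist L] : Subring L where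
  carrier := {x : L | ‖x‖ ≤ 1}
  zero_mem' := by simp
  one_mem' := by simp
  add_mem' := fun ha hb =>
    le_trans (IsUltrametricDist.norm_add_le_max _ _) (max_le ha hb)
  mul_mem' := fun ha hb => by
    rw [Set.mem_setOf_eq, norm_mul]; exact mul_le_one₀ ha (norm_nonneg _) hb
  neg_mem' := fun ha => by rw [Set.mem_setOf_eq, norm_neg]; exact ha

/-- The ring of integers `K° = {x ∈ K : ‖x‖ ≤ 1}` of a subfield `K` of `L`. -/
def integersOf (K : Subfield L) : Subring L where
  carrier := {x : L | x ∈ K ∧ ‖x‖ ≤ 1}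
  zero_mem' := ⟨K.zero_mem, by simp⟩
  one_mem' := ⟨K.one_mem, by simp⟩
  add_mem' := fun ha hb => ⟨K.add_mem ha.1 hb.1,
    le_trans (IsUltrametricDist.norm_add_le_max _ _) (max_le ha.2 hb.2)⟩
  mul_mem' := fun ha hb => ⟨K.mul_mem ha.1 hb.1, by
    rw [norm_mul]; exact mul_le_one₀ ha.2 (norm_nonneg _) hb.2⟩
  neg_mem' := fun ha => ⟨K.neg_mem ha.1, by rw [norm_neg]; exact ha.2⟩

lemma integersOf_le (K : Subfield L) : integersOf K ≤ unitBallSubring L :=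
  fun _ hx => hx.2

noncomputable instance (K : Subfield L) : Algebra (integersOf K) (unitBallSubring L) :=
  (Subring.inclusion (integersOf_le K)).toAlgebra

open scoped IntermediateField.algebraAdjoinAdjoin in
/-- In characteristic zero, a transcendental element is moved by some derivation. -/
theorem exists_derivation_ne_zero_of_transcendental {F L : Type*} [Field F] [Field L]
    [Algebra F L] [CharZero F] {u : L} (hu : Transcendental F u) :
    ∃ D : Derivation F L L, D u ≠ 0 := by
  have hind : AlgebraicIndepOn F id ({u} : Set L) := by
    have h := algebraicIndependent_unique_type_iff (R := F) (ι := ({u} : Set L))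
      (x := fun i ↦ (i : L))
    exact h.2 (by simpa using hu)
  obtain ⟨s, hus, hs⟩ := exists_isTranscendenceBasis_superset (s := ({u} : Set L)) hind
  have hb := hs.1
  let E := IntermediateField.adjoin F (Set.range ((↑) : s → L))
  let A := Algebra.adjoin F (Set.range ((↑) : s → L))
  have : Algebra.FormallyEtale A E := .of_isLocalization (nonZeroDivisors _)
  have : CharZero E := charZero_of_injective_algebraMap (algebraMap F E).injective
  have : Algebra.IsAlgebraic E L := hs.isAlgebraic_field
  have : Algebra.FormallyEtale E L := Algebra.FormallyEtale.of_isSeparable _ L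
  have : Algebra.FormallyEtale A L := .comp _ E _
  let i : s := ⟨u, hus rfl⟩
  have hrepr : ∀ a : A, MvPolynomial.aeval ((↑) : s → L) (hb.repr a) = (a : L) := hb.aeval_repr
  let d : Derivation F A L := Derivation.mk'
    ((MvPolynomial.aeval ((↑) : s → L)).toLinearMap ∘ₗ
      ((MvPolynomial.pderiv i : Derivation F _ _) : _ →ₗ[F] _) ∘ₗ hb.repr.toLinearMap) (by
      intro a b
      simp [Derivation.leibniz, hrepr, Algebra.smul_def])
  let φ : Ω[L⁄F] →ₗ[L] L :=
    (LinearMap.liftBaseChange L d.liftKaehlerDifferential) ∘ₗ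
      (KaehlerDifferential.tensorKaehlerEquivOfFormallyEtale F A L).symm.toLinearMap
  refine ⟨φ.compDer (KaehlerDifferential.D F L), ?_⟩
  let a : A := ⟨u, Algebra.subset_adjoin ⟨i, rfl⟩⟩
  have ha : hb.repr a = MvPolynomial.X i := by
    apply algebraicIndependent_iff_injective_aeval.1 hb
    rw [hrepr, MvPolynomial.aeval_X]
  have h1 : φ.compDer (KaehlerDifferential.D F L) u = d a := by
    have := KaehlerDifferential.tensorKaehlerEquivOfFormallyEtale_symm_D_algebraMap F A L a
    change LinearMap.liftBaseChange L d.liftKaehlerDifferential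
      ((KaehlerDifferential.tensorKaehlerEquivOfFormallyEtale F A L).symm
        (KaehlerDifferential.D F L (algebraMap A L a))) = _
    rw [this]
    simp
  rw [h1]
  simp [d, ha]

open Polynomial

/-- The element `x` of `L°`, or `0` if `x` does not lie in `L°`. -/
noncomputable def ballElt (x : L) : unitBallSubring L :=
  open Classical in if h : ‖x‖ ≤ 1 then ⟨x, h⟩ else 0

theorem coe_ballElt {x : L} (h : ‖x‖ ≤ 1) : (ballElt x : L) = x := by
  simp [ballElt, h]

theorem ballElt_eq {x : L} (h : ‖x‖ ≤ 1) : ballElt x = ⟨x, h⟩ := by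
  simp [ballElt, h]

theorem ballElt_coe (x : unitBallSubring L) : ballElt (x : L) = x :=
  ballElt_eq x.2

theorem ballElt_zero : ballElt (0 : L) = 0 :=
  ballElt_coe 0

theorem ballElt_one : ballElt (1 : L) = 1 :=
  ballElt_coe 1

theorem ballElt_mul {x y : L} (hx : ‖x‖ ≤ 1) (hy : ‖y‖ ≤ 1) :
    ballElt (x * y) = ballElt x * ballElt y := by
  have hxy : ‖x * y‖ ≤ 1 := by rw [norm_mul]; exact mul_le_one₀ hx (norm_nonneg _) hy
  apply Subtype.ext
  rw [Subring.coe_mul, coe_ballElt hx, coe_ballElt hy, coe_ballElt hxy]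

theorem norm_div_le_one {x y : L} (h : ‖x‖ ≤ ‖y‖) : ‖x / y‖ ≤ 1 := by
  rw [norm_div]
  exact div_le_one_of_le₀ h (norm_nonneg _)

theorem ballElt_add {x y : L} (hx : ‖x‖ ≤ 1) (hy : ‖y‖ ≤ 1) :
    ballElt (x + y) = ballElt x + ballElt y := by
  have hxy : ‖x + y‖ ≤ 1 := (IsUltrametricDist.norm_add_le_max _ _).trans (max_le hx hy)
  apply Subtype.ext
  rw [Subring.coe_add, coe_ballElt hx, coe_ballElt hy, coe_ballElt hxy]

section LogDerivation

variable {N : Type*} [AddCommGroup N] [Module (unitBallSubring L) N]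

/-- `lam : L → N` is a logarithmic derivation over the subfield `F`: a homomorphism on `Lˣ`,
trivial on `F`, such that `x ↦ x • lam x` is additive on `L°`. -/
structure IsLogDerivation (F : Subfield L) (lam : L → N) : Prop where
  map_mul : ∀ x y, x ≠ 0 → y ≠ 0 → lam (x * y) = lam x + lam y
  map_add : ∀ x y, ‖x‖ ≤ 1 → ‖y‖ ≤ 1 →
    ballElt (x + y) • lam (x + y) = ballElt x • lam x + ballElt y • lam y
  map_mem : ∀ x ∈ F, lam x = 0

namespace IsLogDerivation

variable {F : Subfield L} {lam : L → N}

theorem map_div (h : IsLogDerivation F lam) {x y : L} (hx : x ≠ 0) (hy : y ≠ 0) :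
    lam (x / y) = lam x - lam y := by
  rw [eq_sub_iff_add_eq, ← h.map_mul _ _ (div_ne_zero hx hy) hy, div_mul_cancel₀ _ hy]

theorem map_add_scaled (h : IsLogDerivation F lam) {x y μ : L} (hμ : μ ≠ 0)
    (hx : ‖x‖ ≤ ‖μ‖) (hy : ‖y‖ ≤ ‖μ‖) :
    ballElt ((x + y) / μ) • lam (x + y) = ballElt (x / μ) • lam x + ballElt (y / μ) • lam y := by
  have key : ∀ z : L, ballElt (z / μ) • lam z =
      ballElt (z / μ) • lam (z / μ) + ballElt (z / μ) • lam μ := by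
    intro z
    rcases eq_or_ne z 0 with rfl | hz
    · simp [ballElt_zero]
    · rw [h.map_div hz hμ, smul_sub, sub_add_cancel]
  rw [key, key x, key y, add_div, h.map_add _ _ (norm_div_le_one hx) (norm_div_le_one hy),
    ballElt_add (norm_div_le_one hx) (norm_div_le_one hy), add_smul]
  abel

theorem map_mul_scaled (h : IsLogDerivation F lam) {x y μ ν : L}
    (hx : ‖x‖ ≤ ‖μ‖) (hy : ‖y‖ ≤ ‖ν‖) :
    ballElt (x * y / (μ * ν)) • lam (x * y) =
      ballElt (y / ν) • ballElt (x / μ) • lam x + ballElt (x / μ) • ballElt (y / ν) • lam y := by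
  rcases eq_or_ne x 0 with rfl | hx0
  · simp [ballElt_zero]
  rcases eq_or_ne y 0 with rfl | hy0
  · simp [ballElt_zero]
  rw [h.map_mul _ _ hx0 hy0, mul_div_mul_comm,
    ballElt_mul (norm_div_le_one hx) (norm_div_le_one hy), smul_add, mul_smul, mul_smul,
    smul_comm]

end IsLogDerivation

end LogDerivation

section Gauss

/-- `k` is the largest index at which the coefficients of `f` attain their maximal norm. -/
def IsGaussIndex (f : L[X]) (k : ℕ) : Prop :=
  f.coeff k ≠ 0 ∧ (∀ j, ‖f.coeff j‖ ≤ ‖f.coeff k‖) ∧ ∀ j, k < j → ‖f.coeff j‖ < ‖f.coeff k‖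

theorem exists_isGaussIndex {f : L[X]} (hf : f ≠ 0) : ∃ k, IsGaussIndex f k := by
  classical
  obtain ⟨k₀, hk₀, hmax⟩ := f.support.exists_max_image (fun j ↦ ‖f.coeff j‖)
    (support_nonempty.2 hf)
  have hle : ∀ j, ‖f.coeff j‖ ≤ ‖f.coeff k₀‖ := by
    intro j
    by_cases hj : j ∈ f.support
    · exact hmax j hj
    · rw [notMem_support_iff.1 hj, norm_zero]
      exact norm_nonneg _
  obtain ⟨k, hk, hkmax⟩ := (f.support.filter fun j ↦
    ‖f.coeff k₀‖ ≤ ‖f.coeff j‖).exists_max_image id ⟨k₀, by simpa using mem_support_iff.1 hk₀⟩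
  rw [Finset.mem_filter] at hk
  refine ⟨k, mem_support_iff.1 hk.1, fun j ↦ (hle j).trans hk.2, fun j hj ↦ ?_⟩
  by_contra! hlt
  have hj0 : j ∈ f.support := by
    rw [mem_support_iff, ← norm_pos_iff]
    exact (norm_pos_iff.2 (mem_support_iff.1 hk.1)).trans_le hlt
  exact absurd (hkmax j (by simp [hj0, hk.2.trans hlt])) (not_le.2 hj)

theorem IsGaussIndex.norm_coeff_mul {f g : L[X]} {k m : ℕ} (hf : IsGaussIndex f k)
    (hg : IsGaussIndex g m) : ‖(f * g).coeff (k + m)‖ = ‖f.coeff k‖ * ‖g.coeff m‖ := by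
  classical
  have hpos : 0 < ‖f.coeff k * g.coeff m‖ := norm_pos_iff.2 (mul_ne_zero hf.1 hg.1)
  have hmem : (k, m) ∈ Finset.HasAntidiagonal.antidiagonal (k + m) := by simp
  rw [coeff_mul, ← Finset.add_sum_erase _ _ hmem, ← norm_mul]
  have hlt : ‖∑ x ∈ (Finset.HasAntidiagonal.antidiagonal (k + m)).erase (k, m),
      f.coeff x.1 * g.coeff x.2‖ <
      ‖f.coeff k * g.coeff m‖ := by
    rcases ((Finset.HasAntidiagonal.antidiagonal (k + m)).erase
      (k, m)).eq_empty_or_nonempty with he | hne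
    · rwa [he, Finset.sum_empty, norm_zero]
    obtain ⟨⟨i, j⟩, hij, hle⟩ := IsUltrametricDist.exists_norm_finsetSum_le_of_nonempty hne
      fun x ↦ f.coeff x.1 * g.coeff x.2
    refine hle.trans_lt ?_
    simp only [Finset.mem_erase, Finset.HasAntidiagonal.mem_antidiagonal, ne_eq,
      Prod.mk.injEq] at hij
    rw [norm_mul, norm_mul]
    rcases lt_or_ge k i with hi | hi
    · exact mul_lt_mul_of_lt_of_le_of_nonneg_of_pos (hf.2.2 i hi) (hg.2.1 j) (norm_nonneg _)
        (norm_pos_iff.2 hg.1)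
    · exact mul_lt_mul_of_le_of_lt_of_nonneg_of_pos (hf.2.1 i) (hg.2.2 j (by omega))
        (norm_nonneg _) (norm_pos_iff.2 hf.1)
  rw [IsUltrametricDist.norm_add_eq_max_of_norm_ne_norm hlt.ne', max_eq_left hlt.le]

theorem IsGaussIndex.norm_coeff_mul_le {f g : L[X]} {k m : ℕ} (hf : IsGaussIndex f k)
    (hg : IsGaussIndex g m) (j : ℕ) : ‖(f * g).coeff j‖ ≤ ‖f.coeff k‖ * ‖g.coeff m‖ := by
  rw [coeff_mul]
  refine IsUltrametricDist.norm_sum_le_of_forall_le_of_nonneg (by positivity) fun x _ ↦ ?_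
  rw [norm_mul]
  exact mul_le_mul (hf.2.1 _) (hg.2.1 _) (norm_nonneg _) (norm_nonneg _)

end Gauss

section Adapted

variable {N : Type*} [AddCommGroup N] [Module (unitBallSubring L) N]

/-- For the expansion `p` in a scaled local coordinate of an element `p₀`, and `e` playing the
role of the differential of that coordinate: `p₀ • lam p₀ = p₁ • e`, divided by any `μ` bounding
the coefficients of `p`. -/
def IsAdapted (lam : L → N) (e : N) (p : L[X]) : Prop :=
  ∀ μ : L, μ ≠ 0 → (∀ b, ‖p.coeff b‖ ≤ ‖μ‖) →
    ballElt (p.coeff 0 / μ) • lam (p.coeff 0) = ballElt (p.coeff 1 / μ) • e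

variable {F : Subfield L} {lam : L → N} {e : N}

theorem IsAdapted.mul (hlam : IsLogDerivation F lam) {p q : L[X]} (hp : IsAdapted lam e p)
    (hq : IsAdapted lam e q) : IsAdapted lam e (p * q) := by
  intro μ hμ hb
  rcases eq_or_ne p 0 with rfl | hp0
  · simp [ballElt_zero]
  rcases eq_or_ne q 0 with rfl | hq0
  · simp [ballElt_zero]
  obtain ⟨k, hk⟩ := exists_isGaussIndex hp0
  obtain ⟨m, hm⟩ := exists_isGaussIndex hq0
  have hkm : ‖p.coeff k * q.coeff m‖ ≤ ‖μ‖ := by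
    rw [norm_mul, ← hk.norm_coeff_mul hm]
    exact hb _
  have hp' := hp _ hk.1 hk.2.1
  have hq' := hq _ hm.1 hm.2.1
  have hμk := hk.1
  have hμm := hm.1
  have hp0k := norm_div_le_one (hk.2.1 0)
  have hp1k := norm_div_le_one (hk.2.1 1)
  have hq0m := norm_div_le_one (hm.2.1 0)
  have hq1m := norm_div_le_one (hm.2.1 1)
  set a := p.coeff k
  set b := q.coeff m
  have hle : ∀ {x y : L}, ‖x‖ ≤ 1 → ‖y‖ ≤ 1 → ‖x * y‖ ≤ 1 := fun hx hy ↦ by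
    rw [norm_mul]; exact mul_le_one₀ hx (norm_nonneg _) hy
  have h0 : ballElt (p.coeff 0 * q.coeff 0 / μ) =
      ballElt (a * b / μ) * ballElt (p.coeff 0 * q.coeff 0 / (a * b)) := by
    rw [← ballElt_mul (norm_div_le_one hkm)
      (by rw [mul_div_mul_comm]; exact hle hp0k hq0m)]
    congr 1
    field_simp
  have h1 : ballElt ((p.coeff 0 * q.coeff 1 + p.coeff 1 * q.coeff 0) / μ) =
      ballElt (a * b / μ) * (ballElt (p.coeff 0 / a) * ballElt (q.coeff 1 / b) +
        ballElt (p.coeff 1 / a) * ballElt (q.coeff 0 / b)) := by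
    rw [← ballElt_mul hp0k hq1m, ← ballElt_mul hp1k hq0m,
      ← ballElt_add (hle hp0k hq1m) (hle hp1k hq0m), ← ballElt_mul (norm_div_le_one hkm)
      ((IsUltrametricDist.norm_add_le_max _ _).trans
        (max_le (hle hp0k hq1m) (hle hp1k hq0m)))]
    congr 1
    field_simp
  rw [mul_coeff_zero, mul_coeff_one, h0, h1, mul_smul,
    hlam.map_mul_scaled (hk.2.1 0) (hm.2.1 0), mul_smul, add_smul, mul_smul, mul_smul, hp', hq',
    smul_comm (ballElt (p.coeff 1 / a)), add_comm]

theorem IsAdapted.add_of_bound (hlam : IsLogDerivation F lam) {p q : L[X]}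
    (hp : IsAdapted lam e p) (hq : IsAdapted lam e q) {μ : L} (hμ : μ ≠ 0)
    (hpb : ∀ b, ‖p.coeff b‖ ≤ ‖μ‖) (hqb : ∀ b, ‖q.coeff b‖ ≤ ‖μ‖) :
    ballElt ((p + q).coeff 0 / μ) • lam ((p + q).coeff 0) =
      ballElt ((p + q).coeff 1 / μ) • e := by
  rw [coeff_add, coeff_add, hlam.map_add_scaled hμ (hpb 0) (hqb 0), hp μ hμ hpb, hq μ hμ hqb,
    add_div, ballElt_add (norm_div_le_one (hpb 1)) (norm_div_le_one (hqb 1)), add_smul]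

end Adapted

section LocalExpansion

variable {F : Subfield L}

/-- The expansion `f(u + ϖ X)` of a polynomial `f` over `F`. -/
noncomputable def localExpansion (F : Subfield L) (u ϖ : L) : F[X] →ₐ[F] L[X] :=
  aeval (C u + C ϖ * X)

variable {u ϖ : L}

theorem localExpansion_coeff_zero (f : F[X]) :
    (localExpansion F u ϖ f).coeff 0 = aeval u f := by
  have h : ((aeval (0 : L) : L[X] →ₐ[L] L).restrictScalars F).comp (localExpansion F u ϖ) =
      aeval u := by
    ext
    simp [localExpansion]
  rw [coeff_zero_eq_aeval_zero, ← h]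
  rfl

theorem localExpansion_coeff_succ (f : F[X]) (b : ℕ) :
    (localExpansion F u ϖ f).coeff (b + 1) * (b + 1) =
      ϖ * (localExpansion F u ϖ (derivative f)).coeff b := by
  have h := ((derivative' : Derivation L L[X] L[X]).restrictScalars F).map_aeval f
    (C u + C ϖ * X)
  replace h : derivative (localExpansion F u ϖ f) =
      localExpansion F u ϖ (derivative f) * derivative (C u + C ϖ * X) := h
  rw [← coeff_derivative, h]
  simp only [derivative_add, derivative_C, zero_add, derivative_C_mul, derivative_X, mul_one]
  rw [mul_comm, coeff_C_mul]

theorem localExpansion_coeff_one (f : F[X]) :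
    (localExpansion F u ϖ f).coeff 1 = ϖ * aeval u (derivative f) := by
  simpa [localExpansion_coeff_zero] using localExpansion_coeff_succ (u := u) (ϖ := ϖ) f 0

theorem norm_localExpansion_coeff_succ (hres : ∀ n : ℕ, n ≠ 0 → ‖(n : L)‖ = 1) (f : F[X])
    (b : ℕ) : ‖(localExpansion F u ϖ f).coeff (b + 1)‖ =
      ‖ϖ‖ * ‖(localExpansion F u ϖ (derivative f)).coeff b‖ := by
  rw [← norm_mul, ← localExpansion_coeff_succ, norm_mul]
  have := hres (b + 1) b.succ_ne_zero
  push_cast at this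
  rw [this, mul_one]

/-- The disc of radius `‖ϖ‖` around `u` contains a root of `f`, in terms of the expansion of
`f` at `u`. -/
def HasRootNear (u ϖ : L) (f : F[X]) : Prop :=
  ∃ b, ‖aeval u f‖ ≤ ‖(localExpansion F u ϖ f).coeff (b + 1)‖

/-- A nonzero polynomial of minimal degree among those with a root in the disc of radius `‖ϖ‖`
around `u`. -/
structure IsKeyPoly (u ϖ : L) (P : F[X]) : Prop where
  ne_zero : P ≠ 0
  hasRootNear : HasRootNear u ϖ P
  minimal : ∀ s : F[X], s ≠ 0 → s.natDegree < P.natDegree → ¬ HasRootNear u ϖ s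

theorem exists_isKeyPoly {h : F[X]} (h0 : h ≠ 0) (hh : HasRootNear u ϖ h) :
    ∃ P : F[X], P.natDegree ≤ h.natDegree ∧ IsKeyPoly u ϖ P := by
  classical
  have hex : ∃ n, ∃ P : F[X], P.natDegree = n ∧ P ≠ 0 ∧ HasRootNear u ϖ P :=
    ⟨_, h, rfl, h0, hh⟩
  obtain ⟨P, hPn, hP0, hP⟩ := Nat.find_spec hex
  refine ⟨P, hPn.trans_le (Nat.find_min' hex ⟨h, rfl, h0, hh⟩), hP0, hP, fun s hs hlt hns ↦ ?_⟩
  exact Nat.find_min hex (hPn ▸ hlt) ⟨s, rfl, hs, hns⟩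

theorem HasRootNear.natDegree_pos {f : F[X]} (hf : HasRootNear u ϖ f) (h0 : f ≠ 0) :
    0 < f.natDegree := by
  by_contra hd
  obtain ⟨a, rfl⟩ := natDegree_eq_zero.1 (Nat.eq_zero_of_not_pos hd)
  obtain ⟨b, hb⟩ := hf
  have : a = 0 := by simpa [localExpansion, Polynomial.algebraMap_apply, coeff_C] using hb
  simp [this] at h0

theorem aeval_ne_zero_of_not_hasRootNear {s : F[X]} (hs : ¬ HasRootNear u ϖ s) :
    aeval u s ≠ 0 := by
  intro h
  exact hs ⟨0, by simp [h]⟩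

theorem norm_coeff_le_of_not_hasRootNear {s : F[X]} (hs : ¬ HasRootNear u ϖ s) (b : ℕ) :
    ‖(localExpansion F u ϖ s).coeff b‖ ≤ ‖aeval u s‖ := by
  rcases b with _ | b
  · rw [localExpansion_coeff_zero]
  · simp only [HasRootNear, not_exists, not_le] at hs
    exact (hs b).le

namespace IsKeyPoly

variable {P : F[X]}

theorem natDegree_pos (hP : IsKeyPoly u ϖ P) : 0 < P.natDegree :=
  hP.hasRootNear.natDegree_pos hP.ne_zero

theorem derivative_ne_zero [CharZero L] (hP : IsKeyPoly u ϖ P) : derivative P ≠ 0 := by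
  intro h
  exact hP.natDegree_pos.ne' (derivative_eq_zero.1 h)

theorem norm_coeff_le [CharZero L] (hres : ∀ n : ℕ, n ≠ 0 → ‖(n : L)‖ = 1)
    (hP : IsKeyPoly u ϖ P) (b : ℕ) :
    ‖(localExpansion F u ϖ P).coeff b‖ ≤ ‖(localExpansion F u ϖ P).coeff 1‖ := by
  have hD := hP.minimal _ hP.derivative_ne_zero (natDegree_derivative_lt hP.natDegree_pos.ne')
  have hsucc : ∀ b, ‖(localExpansion F u ϖ P).coeff (b + 1)‖ ≤
      ‖(localExpansion F u ϖ P).coeff 1‖ := by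
    intro b
    rw [norm_localExpansion_coeff_succ hres, localExpansion_coeff_one, norm_mul]
    gcongr
    exact norm_coeff_le_of_not_hasRootNear hD b
  rcases b with _ | b
  · obtain ⟨b, hb⟩ := hP.hasRootNear
    rw [localExpansion_coeff_zero]
    exact hb.trans (hsucc b)
  · exact hsucc b

theorem coeff_one_ne_zero [CharZero L] (hϖ : ϖ ≠ 0) (hP : IsKeyPoly u ϖ P) :
    (localExpansion F u ϖ P).coeff 1 ≠ 0 := by
  rw [localExpansion_coeff_one]
  exact mul_ne_zero hϖ (aeval_ne_zero_of_not_hasRootNear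
    (hP.minimal _ hP.derivative_ne_zero (natDegree_derivative_lt hP.natDegree_pos.ne')))

theorem norm_coeff_remainder_le [CharZero L] (hres : ∀ n : ℕ, n ≠ 0 → ‖(n : L)‖ = 1)
    (hϖ : ϖ ≠ 0) (hP : IsKeyPoly u ϖ P) {q s : F[X]} (hs : s.natDegree < P.natDegree) {μ : L}
    (hμ : ∀ b, ‖(localExpansion F u ϖ (P * q + s)).coeff b‖ ≤ ‖μ‖) (b : ℕ) :
    ‖(localExpansion F u ϖ s).coeff b‖ ≤ ‖μ‖ := by
  rcases eq_or_ne s 0 with rfl | hs0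
  · simp
  have hns := hP.minimal s hs0 hs
  refine (norm_coeff_le_of_not_hasRootNear hns b).trans ?_
  by_contra! hlt
  simp only [map_add, map_mul, coeff_add] at hμ
  simp only [HasRootNear, not_exists, not_le] at hns
  set p := localExpansion F u ϖ P
  set q' := localExpansion F u ϖ q
  have hs0' : (localExpansion F u ϖ s).coeff 0 = aeval u s := localExpansion_coeff_zero s
  have heq : ‖(p * q').coeff 0‖ = ‖aeval u s‖ := by
    by_contra hne
    have := hμ 0
    rw [hs0', IsUltrametricDist.norm_add_eq_max_of_norm_ne_norm hne] at this
    exact absurd ((le_max_right _ _).trans this) (not_le.2 hlt)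
  have hpos : 0 < ‖aeval u s‖ := (norm_nonneg _).trans_lt hlt
  have hq0 : q' ≠ 0 := by
    intro h
    rw [h, mul_zero, coeff_zero, norm_zero] at heq
    exact hpos.ne heq
  have hp0 : p ≠ 0 := fun h ↦
    hP.coeff_one_ne_zero hϖ (by rw [show localExpansion F u ϖ P = 0 from h, coeff_zero])
  obtain ⟨m, hm⟩ := exists_isGaussIndex hp0
  obtain ⟨k, hk⟩ := exists_isGaussIndex hq0
  obtain ⟨j, rfl⟩ : ∃ j, m = j + 1 := by
    refine Nat.exists_eq_succ_of_ne_zero ?_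
    rintro rfl
    exact absurd (hP.norm_coeff_le hres 0) (not_le.2 (hm.2.2 1 one_pos))
  have hv := hm.norm_coeff_mul hk
  have hsv : ‖aeval u s‖ ≤ ‖(p * q').coeff (j + 1 + k)‖ := by
    rw [hv, ← heq]
    exact hm.norm_coeff_mul_le hk 0
  have hjk : j + 1 + k = j + k + 1 := by ring
  have hlt' : ‖(localExpansion F u ϖ s).coeff (j + 1 + k)‖ < ‖(p * q').coeff (j + 1 + k)‖ := by
    refine lt_of_lt_of_le ?_ hsv
    rw [hjk]
    exact hns _
  have := hμ (j + 1 + k)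
  rw [IsUltrametricDist.norm_add_eq_max_of_norm_ne_norm hlt'.ne', max_eq_left hlt'.le] at this
  exact absurd (hsv.trans this) (not_le.2 hlt)

end IsKeyPoly

/-- Two polynomials have a common radius, realised by a root of a polynomial of no larger degree,
at which both are dominated by their value at `u`. -/
theorem exists_common_radius [CharZero L] (hres : ∀ n : ℕ, n ≠ 0 → ‖(n : L)‖ = 1) {n : ℕ}
    (hne : ∀ s : F[X], s ≠ 0 → s.natDegree ≤ n → aeval u s ≠ 0) {f g : F[X]}
    (hf : f.natDegree ≤ n) (hg : g.natDegree ≤ n) (hf0 : f.natDegree ≠ 0) :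
    ∃ (ϖ : L) (h : F[X]), ϖ ≠ 0 ∧ h ≠ 0 ∧ h.natDegree ≤ n ∧
      ϖ * aeval u (derivative h) = aeval u h ∧
      ∀ p ∈ ({f, g, h} : Set F[X]), ∀ b,
        ‖(localExpansion F u ϖ p).coeff b‖ ≤ ‖aeval u p‖ := by
  classical
  let T : Finset F[X] := (((Finset.range (n + 1)).image fun j ↦ derivative^[j] f) ∪
    ((Finset.range (n + 1)).image fun j ↦ derivative^[j] g)).filter fun p ↦ derivative p ≠ 0
  let S : Set F[X] := {p | (∃ j, p = derivative^[j] f) ∨ ∃ j, p = derivative^[j] g}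
  have hST : ∀ p ∈ S, derivative p ≠ 0 → p ∈ T := by
    have key : ∀ f : F[X], f.natDegree ≤ n → ∀ j, derivative (derivative^[j] f) ≠ 0 →
        j < n + 1 := by
      intro f hf j hj
      by_contra! hlt
      rw [iterate_derivative_eq_zero (by omega), derivative_zero] at hj
      exact hj rfl
    rintro p (⟨j, rfl⟩ | ⟨j, rfl⟩) hp
    · simp only [T, Finset.mem_filter, Finset.mem_union, Finset.mem_image, Finset.mem_range]
      exact ⟨Or.inl ⟨j, key f hf j hp, rfl⟩, hp⟩
    · simp only [T, Finset.mem_filter, Finset.mem_union, Finset.mem_image, Finset.mem_range]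
      exact ⟨Or.inr ⟨j, key g hg j hp, rfl⟩, hp⟩
  have hTS : ∀ p ∈ T, p ∈ S ∧ derivative p ≠ 0 := by
    intro p hp
    simp only [T, Finset.mem_filter, Finset.mem_union, Finset.mem_image, Finset.mem_range] at hp
    obtain ⟨⟨j, -, rfl⟩ | ⟨j, -, rfl⟩, hp⟩ := hp
    · exact ⟨Or.inl ⟨j, rfl⟩, hp⟩
    · exact ⟨Or.inr ⟨j, rfl⟩, hp⟩
  have hSder : ∀ p ∈ S, derivative p ∈ S := by
    rintro p (⟨j, rfl⟩ | ⟨j, rfl⟩)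
    · exact Or.inl ⟨j + 1, by rw [Function.iterate_succ_apply']⟩
    · exact Or.inr ⟨j + 1, by rw [Function.iterate_succ_apply']⟩
  have hSdeg : ∀ p ∈ S, p.natDegree ≤ n := by
    rintro p (⟨j, rfl⟩ | ⟨j, rfl⟩)
    · exact (natDegree_iterate_derivative f j).trans (by omega)
    · exact (natDegree_iterate_derivative g j).trans (by omega)
  have hfT : f ∈ T := hST f (Or.inl ⟨0, rfl⟩)
    fun h ↦ hf0 (derivative_eq_zero.1 h)
  obtain ⟨h, hhT, hmin⟩ := T.exists_min_image
    (fun p ↦ ‖aeval u p‖ / ‖aeval u (derivative p)‖) ⟨f, hfT⟩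
  obtain ⟨hhS, hh'⟩ := hTS h hhT
  have hh0 : h ≠ 0 := by rintro rfl; simp at hh'
  have hv : aeval u h ≠ 0 := hne h hh0 (hSdeg h hhS)
  have hv' : aeval u (derivative h) ≠ 0 := hne _ hh' (hSdeg _ (hSder h hhS))
  refine ⟨aeval u h / aeval u (derivative h), h, div_ne_zero hv hv', hh0, hSdeg h hhS,
    div_mul_cancel₀ _ hv', ?_⟩
  have key : ∀ b, ∀ p ∈ S, ‖(localExpansion F u (aeval u h / aeval u (derivative h)) p).coeff b‖ ≤
      ‖aeval u p‖ := by
    intro b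
    induction b with
    | zero => intro p _; rw [localExpansion_coeff_zero]
    | succ b ih =>
      intro p hp
      rw [norm_localExpansion_coeff_succ hres]
      rcases eq_or_ne (derivative p) 0 with hp' | hp'
      · simp [hp']
      have hpos : 0 < ‖aeval u (derivative p)‖ :=
        norm_pos_iff.2 (hne _ hp' (hSdeg _ (hSder p hp)))
      calc _ ≤ ‖aeval u h / aeval u (derivative h)‖ * ‖aeval u (derivative p)‖ := by
            gcongr
            exact ih _ (hSder p hp)
        _ ≤ ‖aeval u p‖ / ‖aeval u (derivative p)‖ * ‖aeval u (derivative p)‖ := by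
            rw [norm_div]
            exact mul_le_mul_of_nonneg_right (hmin p (hST p hp hp')) (norm_nonneg _)
        _ = ‖aeval u p‖ := div_mul_cancel₀ _ hpos.ne'
  rintro p (rfl | rfl | rfl) b
  · exact key b _ (Or.inl ⟨0, rfl⟩)
  · exact key b _ (Or.inr ⟨0, rfl⟩)
  · exact key b _ hhS

end LocalExpansion

section KeyPolynomial

variable {N : Type*} [AddCommGroup N] [Module (unitBallSubring L) N]
  {F : Subfield L} {lam : L → N} {u ϖ : L} {e : N}

theorem IsAdapted.lam_aeval {f : F[X]} (hf : IsAdapted lam e (localExpansion F u ϖ f))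
    (h0 : aeval u f ≠ 0) (hb : ∀ b, ‖(localExpansion F u ϖ f).coeff b‖ ≤ ‖aeval u f‖) :
    lam (aeval u f) = ballElt (ϖ * aeval u (derivative f) / aeval u f) • e := by
  have := hf _ h0 hb
  rwa [localExpansion_coeff_zero, localExpansion_coeff_one, div_self h0, ballElt_one,
    one_smul] at this

theorem IsAdapted.smul_lam_aeval {f : F[X]} (hf : IsAdapted lam e (localExpansion F u ϖ f))
    (h1 : ϖ * aeval u (derivative f) ≠ 0)
    (hb : ∀ b, ‖(localExpansion F u ϖ f).coeff b‖ ≤ ‖ϖ * aeval u (derivative f)‖) :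
    ballElt (aeval u f / (ϖ * aeval u (derivative f))) • lam (aeval u f) = e := by
  have := hf _ h1 hb
  rwa [localExpansion_coeff_zero, localExpansion_coeff_one, div_self h1, ballElt_one,
    one_smul] at this

/-- Under the hypothesis that the differential of the local coordinate exists at all radii cut
out by polynomials of degree at most `n`, two polynomials of degree at most `n` have a common
radius at which everything is adapted. -/
theorem exists_common_isAdapted [CharZero L] (hres : ∀ n : ℕ, n ≠ 0 → ‖(n : L)‖ = 1) {n : ℕ}
    (hne : ∀ s : F[X], s ≠ 0 → s.natDegree ≤ n → aeval u s ≠ 0)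
    (hkey : ∀ (ϖ : L) (P : F[X]), ϖ ≠ 0 → P.natDegree ≤ n → IsKeyPoly u ϖ P →
      ∃ e, ∀ f : F[X], IsAdapted lam e (localExpansion F u ϖ f)) {f g : F[X]}
    (hf : f.natDegree ≤ n) (hg : g.natDegree ≤ n) (hf0 : f.natDegree ≠ 0) :
    ∃ (ϖ : L) (h : F[X]) (e : N), ϖ ≠ 0 ∧ h ≠ 0 ∧ h.natDegree ≤ n ∧
      ϖ * aeval u (derivative h) = aeval u h ∧
      (∀ p ∈ ({f, g, h} : Set F[X]), ∀ b,
        ‖(localExpansion F u ϖ p).coeff b‖ ≤ ‖aeval u p‖) ∧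
      ∀ p : F[X], IsAdapted lam e (localExpansion F u ϖ p) := by
  obtain ⟨ϖ, h, hϖ, hh0, hhn, hh, hb⟩ := exists_common_radius hres hne hf hg hf0
  obtain ⟨P, hPn, hP⟩ := exists_isKeyPoly (u := u) (ϖ := ϖ) hh0
    ⟨0, by rw [localExpansion_coeff_one, hh]⟩
  obtain ⟨e, he⟩ := hkey ϖ P hϖ (hPn.trans hhn) hP
  exact ⟨ϖ, h, e, hϖ, hh0, hhn, hh, hb, he⟩

theorem IsLogDerivation.isAdapted_of_natDegree_eq_zero (hlam : IsLogDerivation F lam) {s : F[X]}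
    (hs : s.natDegree = 0) : IsAdapted lam e (localExpansion F u ϖ s) := by
  obtain ⟨a, rfl⟩ := natDegree_eq_zero.1 hs
  intro μ _ _
  rw [localExpansion_coeff_zero, localExpansion_coeff_one, derivative_C, map_zero, mul_zero,
    zero_div, ballElt_zero, zero_smul, aeval_C,
    show lam (algebraMap F L a) = 0 from hlam.map_mem _ a.2, smul_zero]

theorem IsKeyPoly.isAdapted_of_isAdapted [CharZero L] (hres : ∀ n : ℕ, n ≠ 0 → ‖(n : L)‖ = 1)
    (hlam : IsLogDerivation F lam) (hϖ : ϖ ≠ 0) {P : F[X]} (hP : IsKeyPoly u ϖ P)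
    (hPe : IsAdapted lam e (localExpansion F u ϖ P))
    (hlow : ∀ s : F[X], s.natDegree < P.natDegree → IsAdapted lam e (localExpansion F u ϖ s))
    (f : F[X]) : IsAdapted lam e (localExpansion F u ϖ f) := by
  induction hd : f.natDegree using Nat.strong_induction_on generalizing f with
  | _ d ih =>
    subst hd
    rcases lt_or_ge f.natDegree P.natDegree with hlt | hge
    · exact hlow f hlt
    have hdiv : P * (f / P) + f % P = f := EuclideanDomain.div_add_mod f P
    have hmod : (f % P).natDegree < P.natDegree := natDegree_mod_lt f hP.natDegree_pos.ne'
    have hquot : (f / P).natDegree < f.natDegree := by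
      have hf0 : f ≠ 0 := by
        rintro rfl
        exact (hP.natDegree_pos.trans_le hge).ne' natDegree_zero
      rcases eq_or_ne (f / P) 0 with hq | hq
      · rw [hq, natDegree_zero]
        exact hP.natDegree_pos.trans_le hge
      · exact natDegree_lt_natDegree hq
          (degree_div_lt hf0 (natDegree_pos_iff_degree_pos.1 hP.natDegree_pos))
    intro μ hμ hb
    rw [← hdiv] at hb
    have hrb := hP.norm_coeff_remainder_le hres hϖ hmod hb
    have hPqb : ∀ b, ‖(localExpansion F u ϖ (P * (f / P))).coeff b‖ ≤ ‖μ‖ := by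
      intro b
      have h : (localExpansion F u ϖ (P * (f / P))).coeff b =
          (localExpansion F u ϖ (P * (f / P) + f % P)).coeff b -
            (localExpansion F u ϖ (f % P)).coeff b := by
        rw [map_add, coeff_add, add_sub_cancel_right]
      rw [h, sub_eq_add_neg]
      exact (IsUltrametricDist.norm_add_le_max _ _).trans
        (max_le (hb b) ((norm_neg _).trans_le (hrb b)))
    have hPq : IsAdapted lam e (localExpansion F u ϖ (P * (f / P))) := by
      rw [map_mul]
      exact hPe.mul hlam (ih _ hquot _ rfl)
    have := hPq.add_of_bound hlam (hlow _ hmod) hμ hPqb hrb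
    rwa [← map_add, hdiv] at this

/-- At every radius cut out by a key polynomial there is a differential of the local coordinate
to which all polynomials are adapted. -/
theorem IsKeyPoly.exists_isAdapted [CharZero L] (hres : ∀ n : ℕ, n ≠ 0 → ‖(n : L)‖ = 1)
    (hlam : IsLogDerivation F lam) (hϖ : ϖ ≠ 0) {P : F[X]} (hP : IsKeyPoly u ϖ P) :
    ∃ e, ∀ f : F[X], IsAdapted lam e (localExpansion F u ϖ f) := by
  induction hd : P.natDegree using Nat.strong_induction_on generalizing P ϖ with
  | _ d ih =>
    subst hd
    have hpos := hP.natDegree_pos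
    have hlt : ∀ s : F[X], s.natDegree ≤ P.natDegree - 1 → s.natDegree < P.natDegree := by
      intro s hs
      omega
    have hne : ∀ s : F[X], s ≠ 0 → s.natDegree ≤ P.natDegree - 1 → aeval u s ≠ 0 :=
      fun s hs hsd ↦ aeval_ne_zero_of_not_hasRootNear (hP.minimal s hs (hlt s hsd))
    have hP1 := hP.coeff_one_ne_zero hϖ
    have hPb := hP.norm_coeff_le hres
    rw [localExpansion_coeff_one] at hP1 hPb
    have hP' : (derivative P).natDegree ≤ P.natDegree - 1 := natDegree_derivative_le P
    refine ⟨ballElt (aeval u P / (ϖ * aeval u (derivative P))) • lam (aeval u P),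
      hP.isAdapted_of_isAdapted hres hlam hϖ ?_ fun s hs ↦ ?_⟩
    · intro μ hμ hb
      have hb0 := hb 0
      have hb1 := hb 1
      have hPb0 := hPb 0
      rw [localExpansion_coeff_zero] at hb0 hPb0
      rw [localExpansion_coeff_one] at hb1
      rw [localExpansion_coeff_zero, localExpansion_coeff_one, smul_smul,
        ← ballElt_mul (norm_div_le_one hb1) (norm_div_le_one hPb0)]
      have := right_ne_zero_of_mul hP1
      congr 2
      field_simp
    · rcases eq_or_ne s.natDegree 0 with hs0 | hs0
      · exact hlam.isAdapted_of_natDegree_eq_zero hs0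
      have hs0' : s ≠ 0 := by
        rintro rfl
        simp at hs0
      obtain ⟨ϖ₁, h, e₁, hϖ₁, hh0, hhn, hh, hb, he₁⟩ := exists_common_isAdapted (lam := lam) hres
        hne (fun ϖ Q hϖ hQ hQk ↦ ih _ (hlt Q hQ) hϖ hQk rfl) (Nat.le_sub_one_of_lt hs) hP' hs0
      have hle : ‖ϖ‖ ≤ ‖ϖ₁‖ := by
        have hh' := hP.minimal h hh0 (hlt h hhn)
        simp only [HasRootNear, not_exists, not_le] at hh'
        have := hh' 0
        rw [localExpansion_coeff_one, ← hh, norm_mul, norm_mul] at this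
        exact (lt_of_mul_lt_mul_right this (norm_nonneg _)).le
      have hP1' : ϖ₁ * aeval u (derivative P) ≠ 0 :=
        mul_ne_zero hϖ₁ (right_ne_zero_of_mul hP1)
      have hπ : ‖aeval u P‖ ≤ ‖ϖ * aeval u (derivative P)‖ := by
        simpa only [localExpansion_coeff_zero] using hPb 0
      have hπ₁ : ‖aeval u P‖ ≤ ‖ϖ₁ * aeval u (derivative P)‖ := by
        refine hπ.trans ?_
        rw [norm_mul, norm_mul]
        gcongr
      have hPb₁ : ∀ b, ‖(localExpansion F u ϖ₁ P).coeff b‖ ≤ ‖ϖ₁ * aeval u (derivative P)‖ := by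
        rintro (_ | b)
        · rwa [localExpansion_coeff_zero]
        · rw [norm_localExpansion_coeff_succ hres, norm_mul]
          gcongr
          exact hb _ (by simp) b
      have hv : aeval u s ≠ 0 := hne s hs0' (Nat.le_sub_one_of_lt hs)
      have hsb := hb s (by simp)
      have hsb1 := hsb 1
      rw [localExpansion_coeff_one] at hsb1
      intro μ hμ hsμ
      have hsμ0 := hsμ 0
      have hsμ1 := hsμ 1
      rw [localExpansion_coeff_zero] at hsμ0
      rw [localExpansion_coeff_one] at hsμ1
      rw [localExpansion_coeff_zero, localExpansion_coeff_one, (he₁ s).lam_aeval hv hsb,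
        ← (he₁ P).smul_lam_aeval hP1' hPb₁]
      simp only [smul_smul]
      congr 1
      apply Subtype.ext
      simp only [Subring.coe_mul]
      rw [coe_ballElt (norm_div_le_one hsμ0), coe_ballElt (norm_div_le_one hsb1),
        coe_ballElt (norm_div_le_one hπ₁), coe_ballElt (norm_div_le_one hsμ1),
        coe_ballElt (norm_div_le_one hπ)]
      have := right_ne_zero_of_mul hP1
      field_simp

end KeyPolynomial

section SimpleExtension

variable {N : Type*} [AddCommGroup N] [Module (unitBallSubring L) N]
  {F : Subfield L} {lam : L → N} {u : L}

theorem IsLogDerivation.lam_aeval_of_natDegree_eq_zero (hlam : IsLogDerivation F lam) {f : F[X]}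
    (hf : f.natDegree = 0) : lam (aeval u f) = 0 := by
  obtain ⟨a, rfl⟩ := natDegree_eq_zero.1 hf
  rw [aeval_C]
  exact hlam.map_mem _ a.2

theorem IsLogDerivation.lam_aeval_of_isIntegral [CharZero L]
    (hres : ∀ n : ℕ, n ≠ 0 → ‖(n : L)‖ = 1) (hlam : IsLogDerivation F lam) (hu : IsIntegral F u)
    (f : F[X]) : lam (aeval u f) = 0 := by
  rw [← aeval_modByMonic_eq_self_of_root (minpoly.aeval F u)]
  have hdeg := minpoly.natDegree_pos hu
  have hf : (f %ₘ minpoly F u).natDegree ≤ (minpoly F u).natDegree - 1 :=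
    Nat.le_sub_one_of_lt (natDegree_modByMonic_lt _ (minpoly.monic hu) (minpoly.ne_one F u))
  set g := f %ₘ minpoly F u
  have hne : ∀ s : F[X], s ≠ 0 → s.natDegree ≤ (minpoly F u).natDegree - 1 → aeval u s ≠ 0 := by
    intro s hs hsd h0
    have := natDegree_le_natDegree (minpoly.degree_le_of_ne_zero F u hs h0)
    omega
  rcases eq_or_ne g.natDegree 0 with hg | hg
  · exact hlam.lam_aeval_of_natDegree_eq_zero hg
  have hg0 : g ≠ 0 := by
    intro h
    rw [h, natDegree_zero] at hg
    exact hg rfl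
  have hm' : derivative (minpoly F u) ≠ 0 := fun h ↦ hdeg.ne' (derivative_eq_zero.1 h)
  obtain ⟨ϖ, h, e, hϖ, -, -, -, hb, he⟩ := exists_common_isAdapted (lam := lam) hres hne
    (fun ϖ P hϖ _ hP ↦ hP.exists_isAdapted hres hlam hϖ) hf
    (natDegree_derivative_le (minpoly F u)) hg
  have he0 : e = 0 := by
    rw [← (he (minpoly F u)).smul_lam_aeval
      (mul_ne_zero hϖ (hne _ hm' (natDegree_derivative_le _))), minpoly.aeval, zero_div,
      ballElt_zero, zero_smul]
    rintro (_ | b)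
    · rw [localExpansion_coeff_zero, minpoly.aeval, norm_zero]
      exact norm_nonneg _
    · rw [norm_localExpansion_coeff_succ hres, norm_mul]
      gcongr
      exact hb _ (by simp) b
  rw [(he g).lam_aeval (hne _ hg0 hf) (hb g (by simp)), he0, smul_zero]

theorem IsLogDerivation.exists_dominating [CharZero L] (hres : ∀ n : ℕ, n ≠ 0 → ‖(n : L)‖ = 1)
    (hlam : IsLogDerivation F lam) (hu : Transcendental F u) {f g : F[X]} (hf : f ≠ 0)
    (hg : g ≠ 0) : ∃ h : F[X], h ≠ 0 ∧
      (∃ a : unitBallSubring L, lam (aeval u f) = a • lam (aeval u h)) ∧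
      ∃ b : unitBallSubring L, lam (aeval u g) = b • lam (aeval u h) := by
  rcases eq_or_ne f.natDegree 0 with hf0 | hf0
  · exact ⟨g, hg, ⟨0, by rw [hlam.lam_aeval_of_natDegree_eq_zero hf0, zero_smul]⟩,
      1, (one_smul _ _).symm⟩
  have hne : ∀ s : F[X], s ≠ 0 → aeval u s ≠ 0 := fun s hs h0 ↦ hu ⟨s, hs, h0⟩
  obtain ⟨ϖ, h, e, hϖ, hh0, -, hh, hb, he⟩ := exists_common_isAdapted (lam := lam) hres
    (fun s hs _ ↦ hne s hs) (fun ϖ P hϖ _ hP ↦ hP.exists_isAdapted hres hlam hϖ)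
    (le_max_left f.natDegree g.natDegree) (le_max_right f.natDegree g.natDegree) hf0
  have hhe : lam (aeval u h) = e := by
    rw [(he h).lam_aeval (hne _ hh0) (hb h (by simp)), hh, div_self (hne _ hh0), ballElt_one,
      one_smul]
  exact ⟨h, hh0, ⟨_, hhe ▸ (he f).lam_aeval (hne _ hf) (hb f (by simp))⟩,
    _, hhe ▸ (he g).lam_aeval (hne _ hg) (hb g (by simp))⟩

theorem IsLogDerivation.exists_eq_smul_of_mem_span [CharZero L]
    (hres : ∀ n : ℕ, n ≠ 0 → ‖(n : L)‖ = 1) (hlam : IsLogDerivation F lam)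
    (hu : Transcendental F u) {y : N}
    (hy : y ∈ Submodule.span (unitBallSubring L) (lam '' (IntermediateField.adjoin F {u}))) :
    ∃ h : F[X], h ≠ 0 ∧ ∃ b : unitBallSubring L, y = b • lam (aeval u h) := by
  have hadd : ∀ y z : N, (∃ h : F[X], h ≠ 0 ∧ ∃ b : unitBallSubring L, y = b • lam (aeval u h)) →
      (∃ h : F[X], h ≠ 0 ∧ ∃ b : unitBallSubring L, z = b • lam (aeval u h)) →
      ∃ h : F[X], h ≠ 0 ∧ ∃ b : unitBallSubring L, y + z = b • lam (aeval u h) := by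
    rintro _ _ ⟨f, hf, a, rfl⟩ ⟨g, hg, b, rfl⟩
    obtain ⟨h, hh, ⟨a', ha'⟩, b', hb'⟩ := hlam.exists_dominating hres hu hf hg
    exact ⟨h, hh, a * a' + b * b', by rw [ha', hb', add_smul, mul_smul, mul_smul]⟩
  have hsmul : ∀ (a : unitBallSubring L) (y : N),
      (∃ h : F[X], h ≠ 0 ∧ ∃ b : unitBallSubring L, y = b • lam (aeval u h)) →
      ∃ h : F[X], h ≠ 0 ∧ ∃ b : unitBallSubring L, a • y = b • lam (aeval u h) := by
    rintro a _ ⟨f, hf, b, rfl⟩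
    exact ⟨f, hf, a * b, by rw [mul_smul]⟩
  have hzero : ∃ h : F[X], h ≠ 0 ∧ ∃ b : unitBallSubring L, (0 : N) = b • lam (aeval u h) :=
    ⟨1, one_ne_zero, 0, (zero_smul _ _).symm⟩
  induction hy using Submodule.span_induction with
  | zero => exact hzero
  | add y z _ _ hy hz => exact hadd y z hy hz
  | smul a y _ hy => exact hsmul a y hy
  | mem y hy =>
    obtain ⟨x, hx, rfl⟩ := hy
    obtain ⟨r, s, rfl⟩ := (IntermediateField.mem_adjoin_simple_iff F x).1 hx
    have hne : ∀ s : F[X], s ≠ 0 → aeval u s ≠ 0 := fun s hs h0 ↦ hu ⟨s, hs, h0⟩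
    rcases eq_or_ne r 0 with rfl | hr
    · rw [map_zero, zero_div, hlam.map_mem 0 F.zero_mem]
      exact hzero
    rcases eq_or_ne s 0 with rfl | hs
    · rw [map_zero, div_zero, hlam.map_mem 0 F.zero_mem]
      exact hzero
    rw [hlam.map_div (hne r hr) (hne s hs), sub_eq_add_neg, ← neg_one_smul (unitBallSubring L)]
    exact hadd _ _ ⟨r, hr, 1, (one_smul _ _).symm⟩ (hsmul _ _ ⟨s, hs, 1, (one_smul _ _).symm⟩)

/-- An additive functional `ψ` is the logarithmic derivative of the derivation `D` along
`lam`. -/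
def IsLogDerivative (lam : L → N) (D : Derivation ℤ L L) (ψ : N →ₗ[unitBallSubring L] L) : Prop :=
  ∀ x, ψ (lam x) = D x / x

theorem IsLogDerivation.eq_zero_of_mem_span_adjoin [CharZero L]
    (hres : ∀ n : ℕ, n ≠ 0 → ‖(n : L)‖ = 1) (hlam : IsLogDerivation F lam)
    (hex : ∀ D : Derivation ℤ L L, (∀ x ∈ F, D x = 0) → ∃ ψ, IsLogDerivative lam D ψ) {y : N}
    (hy : y ∈ Submodule.span (unitBallSubring L) (lam '' (IntermediateField.adjoin F {u})))
    (hψ : ∀ D : Derivation ℤ L L, (∀ x ∈ F, D x = 0) → ∀ ψ, IsLogDerivative lam D ψ → ψ y = 0) :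
    y = 0 := by
  by_cases hu : IsAlgebraic F u
  · suffices Submodule.span (unitBallSubring L) (lam '' (IntermediateField.adjoin F {u})) ≤ ⊥ from
      (Submodule.mem_bot _).1 (this hy)
    rw [Submodule.span_le]
    rintro _ ⟨x, hx, rfl⟩
    have hzero := hlam.lam_aeval_of_isIntegral hres hu.isIntegral
    obtain ⟨r, s, rfl⟩ := (IntermediateField.mem_adjoin_simple_iff F x).1 hx
    rw [SetLike.mem_coe, Submodule.mem_bot]
    rcases eq_or_ne (aeval u r) 0 with hr | hr
    · rw [hr, zero_div, hlam.map_mem 0 F.zero_mem]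
    rcases eq_or_ne (aeval u s) 0 with hs | hs
    · rw [hs, div_zero, hlam.map_mem 0 F.zero_mem]
    rw [hlam.map_div hr hs, hzero, hzero, sub_zero]
  obtain ⟨h, hh, b, rfl⟩ := hlam.exists_eq_smul_of_mem_span hres hu hy
  rcases eq_or_ne (derivative h) 0 with hh' | hh'
  · rw [hlam.lam_aeval_of_natDegree_eq_zero (derivative_eq_zero.1 hh'), smul_zero]
  have : CharZero F :=
    ⟨fun m n hmn ↦ Nat.cast_injective (R := L) (by exact_mod_cast congrArg (algebraMap F L) hmn)⟩
  obtain ⟨D, hD⟩ := exists_derivation_ne_zero_of_transcendental hu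
  have hDF : ∀ x ∈ F, D.restrictScalars ℤ x = 0 := fun x hx ↦ D.map_algebraMap ⟨x, hx⟩
  obtain ⟨ψ, hψD⟩ := hex _ hDF
  have h0 := hψ _ hDF ψ hψD
  have hne : ∀ s : F[X], s ≠ 0 → aeval u s ≠ 0 := fun s hs h0 ↦ hu ⟨s, hs, h0⟩
  rw [map_smul, hψD, Derivation.restrictScalars_apply, D.map_aeval] at h0
  have hb : b = 0 := by
    apply Subtype.ext
    refine (mul_eq_zero.1 h0).resolve_right ?_
    exact div_ne_zero (mul_ne_zero (hne _ hh') hD) (hne _ hh)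
  rw [hb, zero_smul]

end SimpleExtension

/-- An element of the span of finitely many `lam x` is zero as soon as it is killed by all
logarithmic derivatives. -/
theorem IsLogDerivation.eq_zero_of_forall_isLogDerivative [CharZero L]
    (hres : ∀ n : ℕ, n ≠ 0 → ‖(n : L)‖ = 1) (T : Finset L) {N : Type*} [AddCommGroup N]
    [Module (unitBallSubring L) N] {F : Subfield L} {lam : L → N} (hlam : IsLogDerivation F lam)
    (hex : ∀ D : Derivation ℤ L L, (∀ x ∈ F, D x = 0) → ∃ ψ, IsLogDerivative lam D ψ) {y : N}
    (hy : y ∈ Submodule.span (unitBallSubring L) (lam '' T))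
    (hψ : ∀ D : Derivation ℤ L L, (∀ x ∈ F, D x = 0) → ∀ ψ, IsLogDerivative lam D ψ → ψ y = 0) :
    y = 0 := by
  classical
  induction T using Finset.induction_on generalizing N F with
  | empty => simpa using hy
  | insert u T _ ih =>
    let F' : Subfield L := (IntermediateField.adjoin F {u}).toSubfield
    let S := Submodule.span (unitBallSubring L) (lam '' F')
    have hFF' : F ≤ F' := fun x hx ↦ (IntermediateField.adjoin F {u}).algebraMap_mem ⟨x, hx⟩
    have huF' : u ∈ F' := IntermediateField.mem_adjoin_simple_self F u
    have hmk : ∀ x ∈ F', S.mkQ (lam x) = 0 := fun x hx ↦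
      (Submodule.Quotient.mk_eq_zero S).2 (Submodule.subset_span ⟨x, hx, rfl⟩)
    have hlam' : IsLogDerivation F' (S.mkQ ∘ lam) :=
      { map_mul := fun x y hx hy ↦ by simp only [Function.comp, hlam.map_mul x y hx hy, _root_.map_add]
        map_add := fun x y hx hy ↦ by
          simp only [Function.comp, ← map_smul, hlam.map_add x y hx hy,
            _root_.map_add]
        map_mem := hmk }
    have hyS : S.mkQ y = 0 := by
      refine ih hlam' (fun D hD ↦ ?_) ?_ fun D hD ψ hDψ ↦ ?_
      · obtain ⟨ψ, hDψ⟩ := hex D fun x hx ↦ hD x (hFF' hx)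
        refine ⟨S.liftQ ψ (Submodule.span_le.2 ?_), fun x ↦ ?_⟩
        · rintro _ ⟨x, hx, rfl⟩
          rw [SetLike.mem_coe, LinearMap.mem_ker, hDψ, hD x hx, zero_div]
        · rw [Function.comp, Submodule.mkQ_apply, Submodule.liftQ_apply, hDψ]
      · rw [← Submodule.mem_comap]
        refine Submodule.span_le.2 ?_ hy
        rintro _ ⟨x, hx, rfl⟩
        rw [SetLike.mem_coe, Submodule.mem_comap]
        rcases Finset.mem_insert.1 hx with rfl | hx
        · rw [hmk x huF']
          exact Submodule.zero_mem _
        · exact Submodule.subset_span ⟨x, hx, rfl⟩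
      · exact hψ D (fun x hx ↦ hD x (hFF' hx)) (ψ ∘ₗ S.mkQ) hDψ
    exact hlam.eq_zero_of_mem_span_adjoin hres hex ((Submodule.Quotient.mk_eq_zero S).1 hyS) hψ

section KaehlerDifferential

variable {K : Subfield L}

/-- The differential of an element of `L°`, or `0` for elements outside of `L°`. -/
noncomputable def ballDiff (K : Subfield L) (y : L) : KaehlerDifferential (integersOf K) (unitBallSubring L) :=
  KaehlerDifferential.D (integersOf K) (unitBallSubring L) (ballElt y)

theorem ballDiff_mul {x y : L} (hx : ‖x‖ ≤ 1) (hy : ‖y‖ ≤ 1) :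
    ballDiff K (x * y) = ballElt x • ballDiff K y + ballElt y • ballDiff K x := by
  rw [ballDiff, ballElt_mul hx hy, Derivation.leibniz]
  rfl

theorem ballDiff_of_mem {x : L} (hx : x ∈ K) : ballDiff K x = 0 := by
  by_cases h : ‖x‖ ≤ 1
  · rw [ballDiff, ballElt_eq h]
    exact Derivation.map_algebraMap _ (⟨x, hx, h⟩ : integersOf K)
  · rw [ballDiff, ballElt, dif_neg h, map_zero]

theorem ballDiff_mul_of_mem {x y : L} (hx : ‖x‖ ≤ 1) (hy : ‖y‖ ≤ 1) (hyK : y ∈ K) :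
    ballDiff K (x * y) = ballElt y • ballDiff K x := by
  rw [ballDiff_mul hx hy, ballDiff_of_mem hyK, smul_zero, zero_add]

/-- The logarithmic differential of `y`, multiplied by `c`, for `‖c‖ ≤ ‖y‖ ≤ 1`. -/
noncomputable def windowLog (K : Subfield L) (c y : L) : KaehlerDifferential (integersOf K) (unitBallSubring L) :=
  ballElt (c / y) • ballDiff K y

variable {c : L}

theorem windowLog_mul_of_mem {y k : L} (hc : c ≠ 0) (hk : k ∈ K) (hk0 : k ≠ 0)
    (hy : ‖c‖ ≤ ‖y‖) (hy' : ‖y‖ ≤ 1) (hyk : ‖c‖ ≤ ‖y * k‖) (hyk' : ‖y * k‖ ≤ 1) :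
    windowLog K c (y * k) = windowLog K c y := by
  have key : ∀ {y k : L}, k ∈ K → k ≠ 0 → ‖k‖ ≤ 1 → ‖y‖ ≤ 1 → ‖c‖ ≤ ‖y * k‖ →
      windowLog K c (y * k) = windowLog K c y := by
    intro y k hk hk0 hk1 hy' hyk
    rw [windowLog, windowLog, ballDiff_mul_of_mem hy' hk1 hk, smul_smul,
      ← ballElt_mul (norm_div_le_one hyk) hk1]
    congr 2
    field_simp
  rcases le_total ‖k‖ 1 with hk1 | hk1
  · exact key hk hk0 hk1 hy' hyk
  · have := key (K.inv_mem hk) (inv_ne_zero hk0) (by rw [norm_inv]; exact inv_le_one_of_one_le₀ hk1)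
      hyk' (by rwa [mul_inv_cancel_right₀ hk0])
    rw [← this, mul_inv_cancel_right₀ hk0]

theorem windowLog_mul {x y : L} (hc : c ≠ 0) (hx' : ‖x‖ ≤ 1) (hy' : ‖y‖ ≤ 1)
    (hxy : ‖c‖ ≤ ‖x * y‖) : windowLog K c (x * y) = windowLog K c x + windowLog K c y := by
  have hxy0 : x * y ≠ 0 := norm_pos_iff.1 ((norm_pos_iff.2 hc).trans_le hxy)
  have hx0 := left_ne_zero_of_mul hxy0
  have hy0 := right_ne_zero_of_mul hxy0
  have h1 : ballElt (c / (x * y)) * ballElt x = ballElt (c / y) := by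
    rw [← ballElt_mul (norm_div_le_one hxy) hx']
    congr 1
    field_simp
  have h2 : ballElt (c / (x * y)) * ballElt y = ballElt (c / x) := by
    rw [← ballElt_mul (norm_div_le_one hxy) hy']
    congr 1
    field_simp
  rw [windowLog, ballDiff_mul hx' hy', smul_add, smul_smul, smul_smul, h1, h2, add_comm]
  rfl

theorem windowLog_mul_div {x y : L} (hc : c ≠ 0) (hcK : c ∈ K) (hx : ‖c‖ ≤ ‖x‖)
    (hy : ‖c‖ ≤ ‖y‖) (hy' : ‖y‖ ≤ 1) (hxy : ‖x * y‖ ≤ ‖c‖) :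
    windowLog K c (x * y / c) = windowLog K c x + windowLog K c y := by
  have hx0 : x ≠ 0 := norm_pos_iff.1 ((norm_pos_iff.2 hc).trans_le hx)
  have hy0 : y ≠ 0 := norm_pos_iff.1 ((norm_pos_iff.2 hc).trans_le hy)
  have hcy := norm_div_le_one hy
  have hw := norm_div_le_one hxy
  have hcx := norm_div_le_one hx
  have h0 : ballElt (c / y) • ballDiff K y + ballElt y • ballDiff K (c / y) = 0 := by
    rw [← ballDiff_mul hcy hy', div_mul_cancel₀ _ hy0, ballDiff_of_mem hcK]
  have h1 : ballElt (c / x) * ballElt (x * y / c) = ballElt y := by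
    rw [← ballElt_mul hcx hw]
    congr 1
    field_simp
  have h2 : ballElt (c / x) * ballElt (c / y) = ballElt (c / (x * y / c)) := by
    rw [← ballElt_mul hcx hcy]
    congr 1
    field_simp
  have hx' : x = x * y / c * (c / y) := by field_simp
  have h3 : windowLog K c x = ballElt y • ballDiff K (c / y) + windowLog K c (x * y / c) := by
    rw [windowLog, windowLog]
    conv_lhs => rw [hx']
    rw [ballDiff_mul hw hcy, ← hx', smul_add, smul_smul, smul_smul, h1, h2]
  rw [h3, add_right_comm, windowLog, windowLog, add_comm (ballElt y • _), h0, zero_add]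

theorem exists_mem_window (hc : c ≠ 0) (hcK : c ∈ K) (hc1 : ‖c‖ < 1) {x : L} (hx : x ≠ 0) :
    ∃ k ∈ K, k ≠ 0 ∧ ‖c‖ ≤ ‖x * k‖ ∧ ‖x * k‖ ≤ 1 := by
  have hcpos := norm_pos_iff.2 hc
  obtain ⟨n, hn, hn'⟩ := exists_mem_Ioc_zpow (norm_pos_iff.2 hx) ((one_lt_inv₀ hcpos).2 hc1)
  refine ⟨c ^ (n + 1), zpow_mem hcK _, zpow_ne_zero _ hc, ?_, ?_⟩
  · rw [inv_zpow, inv_lt_iff_one_lt_mul₀ (by positivity)] at hn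
    rw [norm_mul, norm_zpow, zpow_add_one₀ hcpos.ne']
    nlinarith
  · rw [inv_zpow, le_inv_comm₀ (by positivity) (by positivity)] at hn'
    rw [norm_mul, norm_zpow]
    calc _ ≤ ‖x‖ * ‖x‖⁻¹ := by gcongr
      _ = 1 := mul_inv_cancel₀ (norm_pos_iff.2 hx).ne'

open Classical in
/-- The logarithmic differential, multiplied by `c`. -/
noncomputable def scaledLog (K : Subfield L) (c x : L) : KaehlerDifferential (integersOf K) (unitBallSubring L) :=
  if h : ∃ k ∈ K, k ≠ 0 ∧ ‖c‖ ≤ ‖x * k‖ ∧ ‖x * k‖ ≤ 1 then windowLog K c (x * h.choose) else 0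

theorem scaledLog_eq (hc : c ≠ 0) {x k : L} (hk : k ∈ K) (hk0 : k ≠ 0)
    (hxk : ‖c‖ ≤ ‖x * k‖) (hxk' : ‖x * k‖ ≤ 1) : scaledLog K c x = windowLog K c (x * k) := by
  have h : ∃ k ∈ K, k ≠ 0 ∧ ‖c‖ ≤ ‖x * k‖ ∧ ‖x * k‖ ≤ 1 := ⟨k, hk, hk0, hxk, hxk'⟩
  rw [scaledLog, dif_pos h]
  obtain ⟨hl, hl0, hxl, hxl'⟩ := h.choose_spec
  set l := h.choose
  have he : x * l * (k / l) = x * k := by field_simp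
  rw [← he, windowLog_mul_of_mem hc (K.div_mem hk hl) (div_ne_zero hk0 hl0) hxl hxl'
    (by rwa [he]) (by rwa [he])]

theorem scaledLog_zero (hc : c ≠ 0) : scaledLog K c 0 = 0 := by
  rw [scaledLog, dif_neg]
  rintro ⟨k, -, -, hk, -⟩
  rw [zero_mul, norm_zero] at hk
  exact hc (norm_le_zero_iff.1 hk)

theorem ballElt_smul_scaledLog (hc : c ≠ 0) (hcK : c ∈ K) (hc1 : ‖c‖ < 1) {x : L}
    (hx : ‖x‖ ≤ 1) : ballElt x • scaledLog K c x = ballElt c • ballDiff K x := by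
  rcases eq_or_ne x 0 with rfl | hx0
  · rw [scaledLog_zero hc, ballDiff_of_mem K.zero_mem, smul_zero, smul_zero]
  obtain ⟨k, hk, hk0, hxk, hxk'⟩ := exists_mem_window hc hcK hc1 hx0
  rw [scaledLog_eq hc hk hk0 hxk hxk', windowLog]
  have hd := norm_div_le_one hxk
  rcases le_total ‖k‖ 1 with hk1 | hk1
  · rw [ballDiff_mul_of_mem hx hk1 hk, smul_smul, smul_smul]
    congr 1
    apply Subtype.ext
    simp only [Subring.coe_mul]
    rw [coe_ballElt hx, coe_ballElt hd, coe_ballElt hk1, coe_ballElt hc1.le]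
    field_simp
  · have hki : ‖k⁻¹‖ ≤ 1 := by rw [norm_inv]; exact inv_le_one_of_one_le₀ hk1
    have hxe : x = x * k * k⁻¹ := (mul_inv_cancel_right₀ hk0 x).symm
    have hdx : ballDiff K x = ballElt k⁻¹ • ballDiff K (x * k) := by
      conv_lhs => rw [hxe]
      exact ballDiff_mul_of_mem hxk' hki (K.inv_mem hk)
    rw [hdx, smul_smul, smul_smul]
    congr 1
    apply Subtype.ext
    simp only [Subring.coe_mul]
    rw [coe_ballElt hx, coe_ballElt hd, coe_ballElt hki, coe_ballElt hc1.le]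
    field_simp

theorem isLogDerivation_scaledLog (hc : c ≠ 0) (hcK : c ∈ K) (hc1 : ‖c‖ < 1) :
    IsLogDerivation K (scaledLog K c) where
  map_mul x y hx hy := by
    obtain ⟨k, hk, hk0, hxk, hxk'⟩ := exists_mem_window hc hcK hc1 hx
    obtain ⟨l, hl, hl0, hyl, hyl'⟩ := exists_mem_window hc hcK hc1 hy
    rw [scaledLog_eq hc hk hk0 hxk hxk', scaledLog_eq hc hl hl0 hyl hyl']
    rcases le_total ‖c‖ ‖x * k * (y * l)‖ with h | h
    · rw [← windowLog_mul hc hxk' hyl' h]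
      have he : x * y * (k * l) = x * k * (y * l) := by ring
      rw [← he] at h ⊢
      refine scaledLog_eq hc (K.mul_mem hk hl) (mul_ne_zero hk0 hl0) h ?_
      rw [he, norm_mul]
      exact mul_le_one₀ hxk' (norm_nonneg _) hyl'
    · rw [← windowLog_mul_div hc hcK hxk hyl hyl' h]
      have he : x * y * (k * l / c) = x * k * (y * l) / c := by ring
      rw [← he]
      refine scaledLog_eq hc (K.div_mem (K.mul_mem hk hl) hcK)
        (div_ne_zero (mul_ne_zero hk0 hl0) hc) ?_ (he ▸ norm_div_le_one h)
      rw [he, norm_div, le_div_iff₀ (norm_pos_iff.2 hc), norm_mul]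
      gcongr
  map_add x y hx hy := by
    have hxy : ‖x + y‖ ≤ 1 := (IsUltrametricDist.norm_add_le_max _ _).trans (max_le hx hy)
    rw [ballElt_smul_scaledLog hc hcK hc1 hxy, ballElt_smul_scaledLog hc hcK hc1 hx,
      ballElt_smul_scaledLog hc hcK hc1 hy, ← smul_add, ballDiff, ballElt_add hx hy, map_add]
    rfl
  map_mem x hx := by
    rcases eq_or_ne x 0 with rfl | hx0
    · exact scaledLog_zero hc
    obtain ⟨k, hk, hk0, hxk, hxk'⟩ := exists_mem_window hc hcK hc1 hx0
    rw [scaledLog_eq hc hk hk0 hxk hxk', windowLog, ballDiff_of_mem (K.mul_mem hx hk), smul_zero]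

/-- The restriction to `L°` of a derivation of `L` vanishing on `K`. -/
noncomputable def restrictDerivation (D : Derivation ℤ L L) (hD : ∀ x ∈ K, D x = 0) :
    Derivation (integersOf K) (unitBallSubring L) L :=
  Derivation.mk'
    { toFun := fun b ↦ D b
      map_add' := fun a b ↦ by rw [Subring.coe_add, map_add]
      map_smul' := fun r b ↦ by
        have h : ((r • b : unitBallSubring L) : L) = (r : L) * b := rfl
        rw [h, D.leibniz, hD r r.2.1, smul_zero, add_zero]
        rfl }
    fun a b ↦ by
      simp only [LinearMap.coe_mk, AddHom.coe_mk, Subring.coe_mul, D.leibniz]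
      rfl

theorem exists_isLogDerivative_scaledLog (hc : c ≠ 0) (hcK : c ∈ K) (hc1 : ‖c‖ < 1)
    (D : Derivation ℤ L L) (hD : ∀ x ∈ K, D x = 0) :
    ∃ ψ, IsLogDerivative (scaledLog K c) D ψ := by
  have : IsScalarTower (integersOf K) (unitBallSubring L) L := ⟨fun r b x ↦ mul_assoc (r : L) b x⟩
  refine ⟨c⁻¹ • (restrictDerivation D hD).liftKaehlerDifferential, fun x ↦ ?_⟩
  rcases eq_or_ne x 0 with rfl | hx0
  · rw [scaledLog_zero hc, map_zero, div_zero]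
  obtain ⟨k, hk, hk0, hxk, hxk'⟩ := exists_mem_window hc hcK hc1 hx0
  have hd : (restrictDerivation D hD).liftKaehlerDifferential (ballDiff K (x * k)) = k * D x := by
    rw [ballDiff, Derivation.liftKaehlerDifferential_comp_D]
    change D (ballElt (x * k) : L) = _
    rw [coe_ballElt hxk', D.leibniz, hD k hk, smul_zero, zero_add, smul_eq_mul]
  rw [scaledLog_eq hc hk hk0 hxk hxk', windowLog, map_smul, LinearMap.smul_apply, hd]
  change (ballElt (c / (x * k)) : L) * (c⁻¹ * (k * D x)) = D x / x
  rw [coe_ballElt (norm_div_le_one hxk)]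
  field_simp

theorem exists_finset_ballElt_smul_mem_span (hc : c ≠ 0) (hcK : c ∈ K) (hc1 : ‖c‖ < 1)
    (x : KaehlerDifferential (integersOf K) (unitBallSubring L)) : ∃ T : Finset L,
      ballElt c • x ∈ Submodule.span (unitBallSubring L) (scaledLog K c '' T) := by
  classical
  have hx : x ∈ (Submodule.span (unitBallSubring L) (scaledLog K c '' Set.univ)).comap
      (LinearMap.lsmul (unitBallSubring L) _ (ballElt c)) := by
    have hle : Submodule.span (unitBallSubring L) (Set.range
        (KaehlerDifferential.D (integersOf K) (unitBallSubring L))) ≤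
        (Submodule.span (unitBallSubring L) (scaledLog K c '' Set.univ)).comap
          (LinearMap.lsmul (unitBallSubring L) _ (ballElt c)) := by
      rw [Submodule.span_le]
      rintro _ ⟨b, rfl⟩
      have hb : KaehlerDifferential.D (integersOf K) (unitBallSubring L) b = ballDiff K b := by
        rw [ballDiff, ballElt_coe]
      rw [SetLike.mem_coe, Submodule.mem_comap, LinearMap.lsmul_apply, hb,
        ← ballElt_smul_scaledLog hc hcK hc1 b.2]
      exact Submodule.smul_mem _ _ (Submodule.subset_span ⟨b, trivial, rfl⟩)
    rw [KaehlerDifferential.span_range_derivation] at hle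
    exact hle trivial
  obtain ⟨S, hS, hxS⟩ := Submodule.mem_span_finite_of_mem_span hx
  obtain ⟨T, -, rfl⟩ := Finset.subset_set_image_iff.1 hS
  refine ⟨T, ?_⟩
  rwa [Finset.coe_image] at hxS

end KaehlerDifferential

/-- Lemma 4.3.1: for an extension `L/K` of non-archimedean real-valued
fields of residue characteristic zero, every torsion element of the module of Kähler
differentials `Ω_{L°/K°}` is annihilated by every element of the maximal ideal `K°°`. -/
theorem torsion_of_kaehler_killed_by_maximal_ideal (K : Subfield L)
    (hres : ∀ n : ℕ, n ≠ 0 → ‖(n : L)‖ = 1)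
    (x : KaehlerDifferential (integersOf K) (unitBallSubring L))
    (a : unitBallSubring L) (ha : a ≠ 0) (hax : a • x = 0) :
    ∀ c : L, c ∈ K → ∀ hc : ‖c‖ < 1,
      (⟨c, le_of_lt hc⟩ : unitBallSubring L) • x = 0 := by
  intro c hcK hc1
  rw [← ballElt_eq hc1.le]
  rcases eq_or_ne c 0 with rfl | hc
  · rw [ballElt_zero, zero_smul]
  have : CharZero L := charZero_of_inj_zero fun n hn ↦ by
    by_contra hn0
    simpa [hn] using hres n hn0
  obtain ⟨T, hT⟩ := exists_finset_ballElt_smul_mem_span hc hcK hc1 x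
  refine (isLogDerivation_scaledLog hc hcK hc1).eq_zero_of_forall_isLogDerivative hres T
    (exists_isLogDerivative_scaledLog hc hcK hc1) hT fun D _ ψ _ ↦ ?_
  have h : (a : L) * ψ x = 0 := by
    change a • ψ x = 0
    rw [← map_smul, hax, map_zero]
  rw [map_smul, (mul_eq_zero.1 h).resolve_left fun h ↦ ha (Subtype.ext h), smul_zero]
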